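/- arXiv:2504.09952 — 2 statements merged into one kernel-verified Lean document; each statement's English description precedes it below -/
import Mathlib

section
/- Let (Ω, μ) be a finite probability space, let F > 0 and M ≥ 0 be reals, and let C > r ≥ 1 and K ≥ 1 be integers. Let W_1,…,W_K, X, Z_1,…,Z_C be random variables with finite ranges such that: (i) H(W_1,…,W_K) = K·F; (ii) H(W_1,…,W_K | X, Z_1,…,Z_C) = 0; (iii) there exist an index k ∈ [K] and a set G ⊆ [C] with |G| = r such that I( (W_i)_{i∈[K], i≠k} ; X, (Z_c)_{c∈G} ) = 0; (iv) H(W_k) ≤ F; and (v) H(Z_c) ≤ M·F for every c ∈ [C]∖G. Then K·F ≤ F + (C−r)·M·F; in particular M ≥ (K−1)/(C−r). -/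
open Finset

/-- Probability that the finitely-valued random variable `X` takes the value `a`,
on the finite probability space with mass function `μ`. -/
noncomputable def probOf {Ω α : Type} [Fintype Ω] [DecidableEq α]
    (μ : Ω → ℝ) (X : Ω → α) (a : α) : ℝ :=
  ∑ ω ∈ Finset.univ.filter (fun ω => X ω = a), μ ω

/-- Shannon entropy (in bits) of a finitely-valued random variable. -/
noncomputable def shannonH {Ω α : Type} [Fintype Ω] [Fintype α] [DecidableEq α]
    (μ : Ω → ℝ) (X : Ω → α) : ℝ :=
  (∑ a : α, Real.negMulLog (probOf μ X a)) / Real.log 2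

/-- Conditional Shannon entropy `H(X | Y)` (in bits). -/
noncomputable def condH {Ω α β : Type} [Fintype Ω] [Fintype α] [Fintype β]
    [DecidableEq α] [DecidableEq β] (μ : Ω → ℝ) (X : Ω → α) (Y : Ω → β) : ℝ :=
  shannonH μ (fun ω => (X ω, Y ω)) - shannonH μ Y

/-- Mutual information `I(X ; Y)` (in bits). -/
noncomputable def mutInf {Ω α β : Type} [Fintype Ω] [Fintype α] [Fintype β]
    [DecidableEq α] [DecidableEq β] (μ : Ω → ℝ) (X : Ω → α) (Y : Ω → β) : ℝ :=
  shannonH μ X + shannonH μ Y - shannonH μ (fun ω => (X ω, Y ω))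

section Entropy

variable {Ω α β : Type} [Fintype Ω] {μ : Ω → ℝ}

theorem probOf_nonneg [DecidableEq α] (hμ : ∀ ω, 0 ≤ μ ω) (X : Ω → α) (a : α) :
    0 ≤ probOf μ X a :=
  Finset.sum_nonneg fun ω _ => hμ ω

theorem le_probOf_self [DecidableEq α] (hμ : ∀ ω, 0 ≤ μ ω) (X : Ω → α) (ω : Ω) :
    μ ω ≤ probOf μ X (X ω) :=
  Finset.single_le_sum (f := μ) (fun ω _ => hμ ω) (by simp)

theorem sum_probOf_mul [Fintype α] [DecidableEq α] (X : Ω → α) (f : α → ℝ) :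
    ∑ a, probOf μ X a * f a = ∑ ω, μ ω * f (X ω) := by
  rw [← Finset.sum_fiberwise Finset.univ X]
  refine Finset.sum_congr rfl fun a _ => ?_
  rw [probOf, Finset.sum_mul]
  refine Finset.sum_congr rfl fun ω hω => ?_
  rw [(Finset.mem_filter.1 hω).2]

theorem sum_probOf [Fintype α] [DecidableEq α] (X : Ω → α) :
    ∑ a, probOf μ X a = ∑ ω, μ ω := by
  simpa using sum_probOf_mul (μ := μ) X fun _ => 1

/-- Entropy as the expected information content. -/
theorem shannonH_eq_sum [Fintype α] [DecidableEq α] (X : Ω → α) :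
    shannonH μ X = (∑ ω, μ ω * -Real.log (probOf μ X (X ω))) / Real.log 2 := by
  rw [shannonH, ← sum_probOf_mul X fun a => -Real.log (probOf μ X a)]
  simp [Real.negMulLog]

/-- A random variable determined by another one has smaller entropy. -/
theorem shannonH_le_of_determined [Fintype α] [DecidableEq α] [Fintype β] [DecidableEq β]
    (hμ : ∀ ω, 0 ≤ μ ω) (X : Ω → α) (Y : Ω → β) (h : ∀ ω ω', X ω = X ω' → Y ω = Y ω') :
    shannonH μ Y ≤ shannonH μ X := by
  rw [shannonH_eq_sum, shannonH_eq_sum]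
  refine div_le_div_of_nonneg_right (Finset.sum_le_sum fun ω _ => ?_)
    (Real.log_nonneg one_le_two)
  rcases (hμ ω).eq_or_lt with h0 | h0
  · simp [← h0]
  refine mul_le_mul_of_nonneg_left (neg_le_neg ?_) h0.le
  refine Real.log_le_log (h0.trans_le (le_probOf_self hμ X ω)) ?_
  refine Finset.sum_le_sum_of_subset_of_nonneg (fun ω' hω' => ?_) fun ω _ _ => hμ ω
  simp only [Finset.mem_filter, Finset.mem_univ, true_and] at hω' ⊢
  exact h _ _ hω'

/-- Entropy is subadditive. -/
theorem shannonH_prod_le [Fintype α] [DecidableEq α] [Fintype β] [DecidableEq β]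
    (hμ : ∀ ω, 0 ≤ μ ω) (hμ1 : ∑ ω, μ ω = 1) (X : Ω → α) (Y : Ω → β) :
    shannonH μ (fun ω => (X ω, Y ω)) ≤ shannonH μ X + shannonH μ Y := by
  set P : Ω → α × β := fun ω => (X ω, Y ω)
  let g : α × β → ℝ := fun p => probOf μ X p.1 * probOf μ Y p.2 / probOf μ P p
  have hg : ∑ ω, μ ω * g (P ω) ≤ 1 := by
    rw [← sum_probOf_mul P g]
    calc ∑ p, probOf μ P p * g p ≤ ∑ p : α × β, probOf μ X p.1 * probOf μ Y p.2 := by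
          refine Finset.sum_le_sum fun p _ => ?_
          have hnn := mul_nonneg (probOf_nonneg hμ X p.1) (probOf_nonneg hμ Y p.2)
          by_cases hp : probOf μ P p = 0
          · simpa [hp] using hnn
          · exact (mul_div_cancel₀ _ hp).le
      _ = 1 := by
          rw [Fintype.sum_prod_type, ← Finset.sum_mul_sum, sum_probOf, sum_probOf, hμ1, mul_one]
  have hle : ∑ ω, μ ω * -Real.log (probOf μ P (P ω)) ≤
      ∑ ω, (μ ω * -Real.log (probOf μ X (X ω)) + μ ω * -Real.log (probOf μ Y (Y ω))
        + (μ ω * g (P ω) - μ ω)) := by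
    refine Finset.sum_le_sum fun ω _ => ?_
    rcases (hμ ω).eq_or_lt with h0 | h0
    · simp [← h0]
    have hX := h0.trans_le (le_probOf_self hμ X ω)
    have hY := h0.trans_le (le_probOf_self hμ Y ω)
    have hXY := h0.trans_le (le_probOf_self hμ P ω)
    have hlog := Real.log_le_sub_one_of_pos (div_pos (mul_pos hX hY) hXY)
    rw [Real.log_div (mul_pos hX hY).ne' hXY.ne', Real.log_mul hX.ne' hY.ne'] at hlog
    have hmul := mul_le_mul_of_nonneg_left hlog h0.le
    simp only [g]
    linarith
  rw [shannonH_eq_sum, shannonH_eq_sum, shannonH_eq_sum, ← add_div]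
  refine div_le_div_of_nonneg_right (hle.trans ?_) (Real.log_nonneg one_le_two)
  rw [Finset.sum_add_distrib, Finset.sum_add_distrib, Finset.sum_sub_distrib, hμ1]
  linarith

theorem shannonH_of_subsingleton [Fintype α] [DecidableEq α] [Subsingleton α]
    (hμ1 : ∑ ω, μ ω = 1) (X : Ω → α) : shannonH μ X = 0 := by
  have h (ω : Ω) : probOf μ X (X ω) = 1 := by
    rw [probOf, Finset.filter_true_of_mem fun _ _ => Subsingleton.elim _ _, hμ1]
  simp [shannonH_eq_sum, h]

/-- The entropy of a finite family is at most the sum of the entropies of its members. -/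
theorem shannonH_pi_le_sum {ι : Type} [DecidableEq ι] {γ : ι → Type} [∀ i, Fintype (γ i)]
    [∀ i, DecidableEq (γ i)] (hμ : ∀ ω, 0 ≤ μ ω) (hμ1 : ∑ ω, μ ω = 1)
    (Z : ∀ i, Ω → γ i) (s : Finset ι) :
    shannonH μ (fun ω => fun i : {i // i ∈ s} => Z i.1 ω) ≤ ∑ i ∈ s, shannonH μ (Z i) := by
  induction s using Finset.induction_on with
  | empty =>
    rw [Finset.sum_empty]
    have : IsEmpty {i // i ∈ (∅ : Finset ι)} := ⟨fun i => Finset.notMem_empty _ i.2⟩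
    exact (shannonH_of_subsingleton hμ1 _).le
  | insert a s ha ih =>
    rw [Finset.sum_insert ha]
    refine (shannonH_le_of_determined hμ
      (fun ω => (Z a ω, fun i : {i // i ∈ s} => Z i.1 ω)) _ fun ω ω' h => ?_).trans
      ((shannonH_prod_le hμ hμ1 _ _).trans (by gcongr))
    obtain ⟨h₁, h₂⟩ := Prod.mk.inj h
    funext ⟨i, hi⟩
    rcases Finset.mem_insert.1 hi with rfl | hi
    · exact h₁
    · exact congrFun h₂ ⟨i, hi⟩

end Entropy

/-- cut-set memory bound, abstract form: on a finite probability
space, if the `K` files are jointly of entropy `K·F`, are determined by the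
transmission `X` together with all `C` caches, some user (index `k`, accessing the
`r` caches in `G`) learns nothing about the other files from `X` and its caches,
`H(W_k) ≤ F`, and every cache outside `G` has entropy at most `M·F`, then
`K·F ≤ F + (C−r)·M·F`; in particular `M ≥ (K−1)/(C−r)`. -/
theorem stmt_2 {Ω : Type} [Fintype Ω] (μ : Ω → ℝ)
    (hμ0 : ∀ ω, 0 ≤ μ ω) (hμ1 : ∑ ω, μ ω = 1)
    (F M : ℝ) (hF : 0 < F) (hM : 0 ≤ M)
    (C r K : ℕ) (hr1 : 1 ≤ r) (hrC : r < C) (hK : 1 ≤ K)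
    {αW : Fin K → Type} [∀ i, Fintype (αW i)] [∀ i, DecidableEq (αW i)]
    {αX : Type} [Fintype αX] [DecidableEq αX]
    {αZ : Fin C → Type} [∀ c, Fintype (αZ c)] [∀ c, DecidableEq (αZ c)]
    (W : ∀ i, Ω → αW i) (X : Ω → αX) (Z : ∀ c, Ω → αZ c)
    (h1 : shannonH μ (fun ω => fun i => W i ω) = (K : ℝ) * F)
    (h2 : condH μ (fun ω => fun i => W i ω) (fun ω => (X ω, fun c => Z c ω)) = 0)
    (k : Fin K) (G : Finset (Fin C)) (hG : G.card = r)
    (h3 : mutInf μ (fun ω => fun i : {i : Fin K // i ≠ k} => W i.1 ω)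
            (fun ω => (X ω, fun c : {c : Fin C // c ∈ G} => Z c.1 ω)) = 0)
    (h4 : shannonH μ (W k) ≤ F)
    (h5 : ∀ c : Fin C, c ∉ G → shannonH μ (Z c) ≤ M * F) :
    (K : ℝ) * F ≤ F + ((C : ℝ) - (r : ℝ)) * M * F ∧
      ((K : ℝ) - 1) / ((C : ℝ) - (r : ℝ)) ≤ M := by
  have hW : shannonH μ (fun ω => fun i => W i ω) ≤
      shannonH μ (W k) + shannonH μ (fun ω => fun i : {i : Fin K // i ≠ k} => W i.1 ω) := by
    refine (shannonH_le_of_determined hμ0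
      (fun ω => (W k ω, fun i : {i : Fin K // i ≠ k} => W i.1 ω)) _ fun ω ω' h => ?_).trans
      (shannonH_prod_le hμ0 hμ1 _ _)
    obtain ⟨hk, hne⟩ := Prod.mk.inj h
    funext i
    by_cases hi : i = k
    · subst hi
      exact hk
    · exact congrFun hne ⟨i, hi⟩
  have hWA : shannonH μ (fun ω => ((fun i : {i : Fin K // i ≠ k} => W i.1 ω),
        (X ω, fun c : {c : Fin C // c ∈ G} => Z c.1 ω))) ≤
      shannonH μ (fun ω => ((fun i => W i ω), (X ω, fun c => Z c ω))) := by
    refine shannonH_le_of_determined hμ0 _ _ fun ω ω' h => ?_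
    simp only [Prod.mk.injEq, funext_iff] at h ⊢
    exact ⟨fun i => h.1 i.1, h.2.1, fun c => h.2.2 c.1⟩
  have hXZ : shannonH μ (fun ω => (X ω, fun c => Z c ω)) ≤
      shannonH μ (fun ω => (X ω, fun c : {c : Fin C // c ∈ G} => Z c.1 ω)) +
        shannonH μ (fun ω => fun c : {c : Fin C // c ∈ Gᶜ} => Z c.1 ω) := by
    refine (shannonH_le_of_determined hμ0
      (fun ω => ((X ω, fun c : {c : Fin C // c ∈ G} => Z c.1 ω),
        fun c : {c : Fin C // c ∈ Gᶜ} => Z c.1 ω)) _ fun ω ω' h => ?_).trans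
      (shannonH_prod_le hμ0 hμ1 _ _)
    simp only [Prod.mk.injEq, funext_iff] at h ⊢
    refine ⟨h.1.1, fun c => ?_⟩
    by_cases hc : c ∈ G
    · exact h.1.2 ⟨c, hc⟩
    · exact h.2 ⟨c, Finset.mem_compl.2 hc⟩
  have hZ : shannonH μ (fun ω => fun c : {c : Fin C // c ∈ Gᶜ} => Z c.1 ω) ≤
      ((C : ℝ) - r) * M * F := by
    refine (shannonH_pi_le_sum hμ0 hμ1 Z Gᶜ).trans
      ((Finset.sum_le_card_nsmul _ _ _ fun c hc => h5 c (Finset.mem_compl.1 hc)).trans_eq ?_)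
    rw [Finset.card_compl, hG, Fintype.card_fin, nsmul_eq_mul, Nat.cast_sub hrC.le, mul_assoc]
  rw [condH] at h2
  rw [mutInf] at h3
  have hmain : (K : ℝ) * F ≤ F + ((C : ℝ) - r) * M * F := by linarith
  refine ⟨hmain, ?_⟩
  have hCr : (0 : ℝ) < (C : ℝ) - r := sub_pos.2 (Nat.cast_lt.2 hrC)
  rw [div_le_iff₀ hCr]
  refine le_of_mul_le_mul_right ?_ hF
  linarith
end

section
/- Let F be a field, n ≥ 1, and let x, y : Fin n → F be functions such that x is injective, y is injective, and x i ≠ y j for all i, j. Then the n×n matrix A with entries A i j = (x i − y j)⁻¹ (a Cauchy matrix) has nonzero determinant, i.e., A is invertible. Consequently, every square submatrix of a rectangular matrix of this form (with injective x : Fin u → F, injective y : Fin v → F, and x i ≠ y j for all i, j) is invertible. -/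
open Polynomial in
/-- If `A i j = (x i - y j)⁻¹` kills `v`, then `∑ j, v j ∏ k ≠ j, (X - y k)` has degree less than
the number of its roots `x i`, so it vanishes; evaluating it at `y j` gives `v j = 0`. -/
theorem Matrix.det_of_inv_sub_ne_zero {ι F : Type*} [Field F] [Fintype ι] [DecidableEq ι]
    {x y : ι → F} (hx : Function.Injective x) (hy : Function.Injective y)
    (hxy : ∀ i j, x i ≠ y j) :
    (Matrix.of fun i j => (x i - y j)⁻¹ : Matrix ι ι F).det ≠ 0 := by
  intro hdet
  obtain ⟨v, hv, hAv⟩ := Matrix.exists_mulVec_eq_zero_iff.mpr hdet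
  let p : F[X] := ∑ j, C (v j) * ∏ k ∈ Finset.univ.erase j, (X - C (y k))
  have hroot : ∀ i, p.eval (x i) = 0 := by
    intro i
    have hsum : ∑ j, (x i - y j)⁻¹ * v j = 0 := congrFun hAv i
    calc p.eval (x i) = (∏ k, (x i - y k)) * ∑ j, (x i - y j)⁻¹ * v j := by
          simp only [p, eval_finsetSum, eval_mul, eval_C, eval_prod, eval_sub, eval_X,
            Finset.mul_sum]
          refine Finset.sum_congr rfl fun j _ => ?_
          rw [← Finset.mul_prod_erase Finset.univ (fun k => x i - y k) (Finset.mem_univ j)]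
          field_simp [sub_ne_zero.mpr (hxy i j)]
      _ = 0 := by rw [hsum, mul_zero]
  have hdeg : p.degree < (Finset.univ : Finset ι).card := by
    refine (degree_sum_le _ _).trans_lt ((Finset.sup_lt_iff (WithBot.bot_lt_coe _)).mpr ?_)
    intro j _
    rw [← smul_eq_C_mul]
    refine (degree_smul_le _ _).trans_lt ?_
    rw [degree_prod]
    simp only [degree_X_sub_C, Finset.sum_const, nsmul_eq_mul, mul_one]
    exact_mod_cast Finset.card_erase_lt_of_mem (Finset.mem_univ j)
  have hp : p = 0 := eq_zero_of_degree_lt_of_eval_index_eq_zero _ hx.injOn hdeg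
    fun i _ => hroot i
  refine hv (funext fun j => ?_)
  have heval : p.eval (y j) = v j * ∏ k ∈ Finset.univ.erase j, (y j - y k) := by
    simp only [p, eval_finsetSum, eval_mul, eval_C, eval_prod, eval_sub, eval_X]
    refine Finset.sum_eq_single_of_mem j (Finset.mem_univ j) fun l _ hl => ?_
    rw [Finset.prod_eq_zero (Finset.mem_erase.mpr ⟨hl.symm, Finset.mem_univ j⟩) (sub_self _),
      mul_zero]
  rw [hp, eval_zero] at heval
  refine (mul_eq_zero.mp heval.symm).resolve_right (Finset.prod_ne_zero_iff.mpr fun k hk => ?_)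
  exact sub_ne_zero.mpr (hy.ne (Finset.ne_of_mem_erase hk).symm)

/-- Cauchy matrices are invertible: if `x, y : Fin n → F` are
injective with `x i ≠ y j` for all `i, j`, then the Cauchy matrix
`A i j = (x i − y j)⁻¹` has nonzero determinant, hence is invertible;
consequently, every square submatrix of a rectangular matrix of this form
(selected by injective row and column index maps) is invertible. -/
theorem stmt_11 (F : Type) [Field F] :
    (∀ (n : ℕ), 1 ≤ n → ∀ (x y : Fin n → F),
      Function.Injective x → Function.Injective y → (∀ i j, x i ≠ y j) →
      (Matrix.of fun i j => (x i - y j)⁻¹ : Matrix (Fin n) (Fin n) F).det ≠ 0 ∧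
        IsUnit (Matrix.of fun i j => (x i - y j)⁻¹ : Matrix (Fin n) (Fin n) F)) ∧
    (∀ (u v : ℕ) (x : Fin u → F) (y : Fin v → F),
      Function.Injective x → Function.Injective y → (∀ i j, x i ≠ y j) →
      ∀ (m : ℕ) (ri : Fin m → Fin u) (ci : Fin m → Fin v),
        Function.Injective ri → Function.Injective ci →
        ((Matrix.of fun i j => (x i - y j)⁻¹ : Matrix (Fin u) (Fin v) F).submatrix
            ri ci).det ≠ 0 ∧
          IsUnit ((Matrix.of fun i j => (x i - y j)⁻¹ :
            Matrix (Fin u) (Fin v) F).submatrix ri ci)) := by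
  have isUnit_of_det {n : ℕ} {A : Matrix (Fin n) (Fin n) F} (h : A.det ≠ 0) : IsUnit A :=
    (Matrix.isUnit_iff_isUnit_det A).mpr h.isUnit
  refine ⟨fun n _ x y hx hy hxy => ?_, fun u v x y hx hy hxy m ri ci hri hci => ?_⟩
  · have h := Matrix.det_of_inv_sub_ne_zero hx hy hxy
    exact ⟨h, isUnit_of_det h⟩
  · have h := Matrix.det_of_inv_sub_ne_zero (hx.comp hri) (hy.comp hci)
      fun i j => hxy (ri i) (ci j)
    exact ⟨h, isUnit_of_det h⟩
end
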